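/- If f is a totally irreducible integral ternary cubic form, then the stabilizer of f in SL₃(ℤ) is trivial: the only γ ∈ SL₃(ℤ) with γ·f = f is the identity. -/

import Mathlib

open MvPolynomial

/-- The action of a 3×3 matrix on ternary forms: `(γ·f)(x,y,z) = f((x,y,z)·γ)`. -/
noncomputable def actGL {R : Type*} [CommRing R] (γ : Matrix (Fin 3) (Fin 3) R)
    (f : MvPolynomial (Fin 3) R) : MvPolynomial (Fin 3) R :=
  bind₁ (fun j => ∑ i : Fin 3, C (γ i j) * X i) f

/-- The Hessian of a ternary form: the determinant of the matrix of second partials. -/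
noncomputable def hess {R : Type*} [CommRing R] (f : MvPolynomial (Fin 3) R) :
    MvPolynomial (Fin 3) R :=
  Matrix.det (Matrix.of fun i j => pderiv i (pderiv j f))

/-- The exponent vectors of the ten monomials of a ternary cubic form. -/
def expo : Fin 10 → Fin 3 → ℕ :=
  ![![3,0,0], ![0,3,0], ![0,0,3], ![2,1,0], ![2,0,1],
    ![1,2,0], ![0,2,1], ![1,0,2], ![0,1,2], ![1,1,1]]

/-- The ternary cubic form with coefficient vector `c : Fin 10 → R`. -/
noncomputable def cubic {R : Type*} [CommRing R] (c : Fin 10 → R) : MvPolynomial (Fin 3) R :=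
  ∑ k : Fin 10, C (c k) * ∏ i : Fin 3, X i ^ expo k i

/-- The coefficient vector of the Weierstrass cubic `x³ + A·x·z² + B·z³ − y²·z`. -/
noncomputable def wcoeffs {R : Type*} [CommRing R] (A B : R) : Fin 10 → R :=
  ![1, 0, B, 0, 0, 0, -1, A, 0, 0]

/-- The generic ternary cubic form, whose coefficients are the 10 indeterminates. -/
noncomputable def genCubic (R : Type*) [CommRing R] :
    MvPolynomial (Fin 3) (MvPolynomial (Fin 10) R) :=
  cubic (fun k => X k)

/-- `P` and `Q` are the invariants `I` and `J`: they are homogeneous of degrees 4 and 6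
in the ten coefficients, they satisfy the identity
`H(H(f)) = 12288·I(f)²·f + 512·J(f)·H(f)` (stated for the generic ternary cubic form,
hence for every ternary cubic form over every commutative `R`-algebra), and they are
normalized so that `x³ + A·x·z² + B·z³ − y²·z` has `I = −3A` and `J = −27B`. -/
def IsInvariantPair (R : Type*) [CommRing R] (P Q : MvPolynomial (Fin 10) R) : Prop :=
  P.IsHomogeneous 4 ∧ Q.IsHomogeneous 6 ∧
  hess (hess (genCubic R)) =
    12288 * C P ^ 2 * genCubic R + 512 * C Q * hess (genCubic R) ∧
  ∀ A B : R, aeval (wcoeffs A B) P = -3 * A ∧ aeval (wcoeffs A B) Q = -27 * B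

/-- An integral ternary cubic form is strongly irreducible if `f` and its Hessian have no
common nontrivial rational zero. -/
def StronglyIrred (c : Fin 10 → ℤ) : Prop :=
  ¬ ∃ v : Fin 3 → ℚ, v ≠ 0 ∧ eval v (cubic fun k => (c k : ℚ)) = 0 ∧
      eval v (hess (cubic fun k => (c k : ℚ))) = 0


section Basic
set_option linter.unusedSimpArgs false
variable {R : Type*} [CommRing R]

/-- Value of the cubic form. -/
def ev (c : Fin 10 → R) (u : Fin 3 → R) : R :=
  c 0 * u 0 ^ 3 + c 1 * u 1 ^ 3 + c 2 * u 2 ^ 3 + c 3 * (u 0 ^ 2 * u 1) + c 4 * (u 0 ^ 2 * u 2)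
    + c 5 * (u 0 * u 1 ^ 2) + c 6 * (u 1 ^ 2 * u 2) + c 7 * (u 0 * u 2 ^ 2)
    + c 8 * (u 1 * u 2 ^ 2) + c 9 * (u 0 * u 1 * u 2)

/-- Directional derivative of the cubic form at `u` in the direction `v`. -/
def dv (c : Fin 10 → R) (u v : Fin 3 → R) : R :=
  v 0 * (3 * c 0 * u 0 ^ 2 + 2 * c 3 * u 0 * u 1 + 2 * c 4 * u 0 * u 2 + c 5 * u 1 ^ 2
      + c 7 * u 2 ^ 2 + c 9 * u 1 * u 2)
  + v 1 * (3 * c 1 * u 1 ^ 2 + c 3 * u 0 ^ 2 + 2 * c 5 * u 0 * u 1 + 2 * c 6 * u 1 * u 2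
      + c 8 * u 2 ^ 2 + c 9 * u 0 * u 2)
  + v 2 * (3 * c 2 * u 2 ^ 2 + c 4 * u 0 ^ 2 + c 6 * u 1 ^ 2 + 2 * c 7 * u 0 * u 2
      + 2 * c 8 * u 1 * u 2 + c 9 * u 0 * u 1)

/-- Full polarization of the cubic form (six times the symmetric trilinear form). -/
def tv (c : Fin 10 → R) (u v w : Fin 3 → R) : R :=
  6 * c 0 * u 0 * v 0 * w 0 + 6 * c 1 * u 1 * v 1 * w 1 + 6 * c 2 * u 2 * v 2 * w 2
  + 2 * c 3 * (u 0 * v 0 * w 1 + u 0 * v 1 * w 0 + u 1 * v 0 * w 0)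
  + 2 * c 4 * (u 0 * v 0 * w 2 + u 0 * v 2 * w 0 + u 2 * v 0 * w 0)
  + 2 * c 5 * (u 1 * v 1 * w 0 + u 1 * v 0 * w 1 + u 0 * v 1 * w 1)
  + 2 * c 6 * (u 1 * v 1 * w 2 + u 1 * v 2 * w 1 + u 2 * v 1 * w 1)
  + 2 * c 7 * (u 2 * v 2 * w 0 + u 2 * v 0 * w 2 + u 0 * v 2 * w 2)
  + 2 * c 8 * (u 2 * v 2 * w 1 + u 2 * v 1 * w 2 + u 1 * v 2 * w 2)
  + c 9 * (u 0 * v 1 * w 2 + u 0 * v 2 * w 1 + u 1 * v 0 * w 2 + u 1 * v 2 * w 0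
      + u 2 * v 0 * w 1 + u 2 * v 1 * w 0)

/-- Coefficient vector of the transformed form. -/
def ac (g : Matrix (Fin 3) (Fin 3) R) (c : Fin 10 → R) : Fin 10 → R :=
  ![ev c (g 0), ev c (g 1), ev c (g 2), dv c (g 0) (g 1), dv c (g 0) (g 2), dv c (g 1) (g 0),
    dv c (g 1) (g 2), dv c (g 2) (g 0), dv c (g 2) (g 1), tv c (g 0) (g 1) (g 2)]

/-- Coefficient vector of the Hessian. -/
def hc (c : Fin 10 → R) : Fin 10 → R :=
  ![
    24*c 0*c 5*c 7 - 6*c 0*c 9^2 - 8*c 3^2*c 7 + 8*c 3*c 4*c 9 - 8*c 4^2*c 5,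
    24*c 1*c 3*c 8 - 6*c 1*c 9^2 - 8*c 3*c 6^2 - 8*c 5^2*c 8 + 8*c 5*c 6*c 9,
    24*c 2*c 4*c 6 - 6*c 2*c 9^2 - 8*c 4*c 8^2 - 8*c 6*c 7^2 + 8*c 7*c 8*c 9,
    72*c 0*c 1*c 7 + 24*c 0*c 5*c 8 - 24*c 0*c 6*c 9 - 24*c 1*c 4^2 - 8*c 3^2*c 8 + 16*c 3*c 4*c 6 - 8*c 3*c 5*c 7 + 2*c 3*c 9^2,
    72*c 0*c 2*c 5 + 24*c 0*c 6*c 7 - 24*c 0*c 8*c 9 - 24*c 2*c 3^2 + 16*c 3*c 4*c 8 - 8*c 4^2*c 6 - 8*c 4*c 5*c 7 + 2*c 4*c 9^2,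
    72*c 0*c 1*c 8 - 24*c 0*c 6^2 + 24*c 1*c 3*c 7 - 24*c 1*c 4*c 9 - 8*c 3*c 5*c 8 + 16*c 4*c 5*c 6 - 8*c 5^2*c 7 + 2*c 5*c 9^2,
    72*c 1*c 2*c 3 + 24*c 1*c 4*c 8 - 24*c 1*c 7*c 9 - 24*c 2*c 5^2 - 8*c 3*c 6*c 8 - 8*c 4*c 6^2 + 16*c 5*c 6*c 7 + 2*c 6*c 9^2,
    72*c 0*c 2*c 6 - 24*c 0*c 8^2 - 24*c 2*c 3*c 9 + 24*c 2*c 4*c 5 + 16*c 3*c 7*c 8 - 8*c 4*c 6*c 7 - 8*c 5*c 7^2 + 2*c 7*c 9^2,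
    72*c 1*c 2*c 4 - 24*c 1*c 7^2 + 24*c 2*c 3*c 6 - 24*c 2*c 5*c 9 - 8*c 3*c 8^2 - 8*c 4*c 6*c 8 + 16*c 5*c 7*c 8 + 2*c 8*c 9^2,
    216*c 0*c 1*c 2 - 24*c 0*c 6*c 8 - 24*c 1*c 4*c 7 - 24*c 2*c 3*c 5 + 24*c 3*c 6*c 7 - 8*c 3*c 8*c 9 + 24*c 4*c 5*c 8 - 8*c 4*c 6*c 9 - 8*c 5*c 7*c 9 + 2*c 9^3
  ]

theorem cubic_expand (c : Fin 10 → R) : cubic c =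
    C (c 0) * X 0 ^ 3 + C (c 1) * X 1 ^ 3 + C (c 2) * X 2 ^ 3 + C (c 3) * (X 0 ^ 2 * X 1)
    + C (c 4) * (X 0 ^ 2 * X 2) + C (c 5) * (X 0 * X 1 ^ 2) + C (c 6) * (X 1 ^ 2 * X 2)
    + C (c 7) * (X 0 * X 2 ^ 2) + C (c 8) * (X 1 * X 2 ^ 2) + C (c 9) * (X 0 * X 1 * X 2) := by
  simp [cubic, Fin.sum_univ_succ, Fin.prod_univ_succ, expo, Fin.succ_zero_eq_one']
  ring

theorem pd0 (c : Fin 10 → R) : pderiv 0 (cubic c) =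
    3 * C (c 0) * X 0 ^ 2 + 2 * C (c 3) * X 0 * X 1 + 2 * C (c 4) * X 0 * X 2 + C (c 5) * X 1 ^ 2
      + C (c 7) * X 2 ^ 2 + C (c 9) * X 1 * X 2 := by
  rw [cubic_expand]
  simp [pderiv_X, Pi.single_apply, Derivation.leibniz]
  ring

theorem pd1 (c : Fin 10 → R) : pderiv 1 (cubic c) =
    3 * C (c 1) * X 1 ^ 2 + C (c 3) * X 0 ^ 2 + 2 * C (c 5) * X 0 * X 1 + 2 * C (c 6) * X 1 * X 2
      + C (c 8) * X 2 ^ 2 + C (c 9) * X 0 * X 2 := by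
  rw [cubic_expand]
  simp [pderiv_X, Pi.single_apply, Derivation.leibniz]
  ring

theorem pd2 (c : Fin 10 → R) : pderiv 2 (cubic c) =
    3 * C (c 2) * X 2 ^ 2 + C (c 4) * X 0 ^ 2 + C (c 6) * X 1 ^ 2 + 2 * C (c 7) * X 0 * X 2
      + 2 * C (c 8) * X 1 * X 2 + C (c 9) * X 0 * X 1 := by
  rw [cubic_expand]
  simp [pderiv_X, Pi.single_apply, Derivation.leibniz]
  ring

theorem pderiv_two (i : Fin 3) : pderiv i (2 : MvPolynomial (Fin 3) R) = 0 := by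
  rw [show (2 : MvPolynomial (Fin 3) R) = C 2 from (map_ofNat C 2).symm, pderiv_C]

theorem pderiv_three (i : Fin 3) : pderiv i (3 : MvPolynomial (Fin 3) R) = 0 := by
  rw [show (3 : MvPolynomial (Fin 3) R) = C 3 from (map_ofNat C 3).symm, pderiv_C]

/-- The Hessian matrix of the cubic form. -/
theorem hess_matrix (c : Fin 10 → R) :
    (Matrix.of fun i j => pderiv i (pderiv j (cubic c))) =
    !![6 * C (c 0) * X 0 + 2 * C (c 3) * X 1 + 2 * C (c 4) * X 2,
       2 * C (c 3) * X 0 + 2 * C (c 5) * X 1 + C (c 9) * X 2,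
       2 * C (c 4) * X 0 + 2 * C (c 7) * X 2 + C (c 9) * X 1;
       2 * C (c 3) * X 0 + 2 * C (c 5) * X 1 + C (c 9) * X 2,
       6 * C (c 1) * X 1 + 2 * C (c 5) * X 0 + 2 * C (c 6) * X 2,
       2 * C (c 6) * X 1 + 2 * C (c 8) * X 2 + C (c 9) * X 0;
       2 * C (c 4) * X 0 + 2 * C (c 7) * X 2 + C (c 9) * X 1,
       2 * C (c 6) * X 1 + 2 * C (c 8) * X 2 + C (c 9) * X 0,
       6 * C (c 2) * X 2 + 2 * C (c 7) * X 0 + 2 * C (c 8) * X 1] := by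
  ext1 i j
  fin_cases i <;> fin_cases j <;>
    simp [pd0, pd1, pd2, pderiv_two, pderiv_three, pderiv_X, Pi.single_apply,
      Derivation.leibniz] <;> ring

theorem hess_cubic (c : Fin 10 → R) : hess (cubic c) = cubic (hc c) := by
  rw [hess, hess_matrix, cubic_expand, Matrix.det_fin_three]
  simp only [Matrix.of_apply, Matrix.cons_val, hc, map_add, map_sub, map_mul, map_pow, map_ofNat]
  ring

theorem act_cubic (g : Matrix (Fin 3) (Fin 3) R) (c : Fin 10 → R) :
    actGL g (cubic c) = cubic (ac g c) := by
  rw [cubic_expand, cubic_expand, actGL]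
  simp [ac, ev, dv, tv, map_ofNat, Fin.sum_univ_three]
  ring

theorem aeval_cubic {S : Type*} [CommRing S] (φ : R →+* S) (c : Fin 10 → R) (u : Fin 3 → S) :
    eval₂ φ u (cubic c) = ev (fun k => φ (c k)) u := by
  rw [cubic_expand, ev]
  simp

theorem cubic_coeff (c : Fin 10 → R) (k : Fin 10) :
    coeff (Finsupp.equivFunOnFinite.symm (expo k)) (cubic c) = c k := by
  have h : ∀ j : Fin 10, (∏ i : Fin 3, X i ^ expo j i : MvPolynomial (Fin 3) R)
      = monomial (Finsupp.equivFunOnFinite.symm (expo j)) 1 := by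
    intro j
    rw [monomial_eq]
    simp [Finsupp.prod_fintype]
  simp only [cubic, h, coeff_sum, coeff_C_mul, coeff_monomial]
  have h2 : ∀ j, (Finsupp.equivFunOnFinite.symm (expo j) = Finsupp.equivFunOnFinite.symm (expo k))
     ↔ j = k := by
    intro j
    rw [Equiv.apply_eq_iff_eq]
    revert j k
    decide
  simp [h2]

theorem cubic_inj {c d : Fin 10 → R} (h : cubic c = cubic d) : c = d := by
  ext k
  rw [← cubic_coeff c, h, cubic_coeff]

theorem pderiv_act (g : Matrix (Fin 3) (Fin 3) R) (f : MvPolynomial (Fin 3) R) (i : Fin 3) :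
    pderiv i (actGL g f) = ∑ j, C (g i j) * actGL g (pderiv j f) := by
  unfold actGL
  induction f using MvPolynomial.induction_on with
  | C a => simp
  | add p q hp hq => simp [hp, hq, mul_add, Finset.sum_add_distrib]
  | mul_X p n hp =>
    simp only [map_mul, Derivation.leibniz, hp, bind₁_X_right, smul_eq_mul, map_add, map_sum,
      pderiv_X, pderiv_C]
    fin_cases n <;> fin_cases i <;> simp [Fin.sum_univ_three, pderiv_X, Pi.single_apply] <;> ring

theorem hess_act (g : Matrix (Fin 3) (Fin 3) R) (f : MvPolynomial (Fin 3) R) :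
    hess (actGL g f) = C (g.det) ^ 2 * actGL g (hess f) := by
  have h1 : (Matrix.of fun i j => pderiv i (pderiv j (actGL g f))) =
      (g.map C) * (((bind₁ (fun j => ∑ i : Fin 3, C (g i j) * X i) :
        MvPolynomial (Fin 3) R →ₐ[R] MvPolynomial (Fin 3) R) : _ →+* _).mapMatrix
        (Matrix.of fun i j => pderiv i (pderiv j f))) * (g.map C).transpose := by
    ext1 i j
    simp only [Matrix.of_apply, pderiv_act, Fin.sum_univ_three, map_add, Derivation.leibniz, pderiv_C, smul_eq_mul,
      mul_zero, add_zero, Matrix.mul_apply, Matrix.map_apply, Matrix.transpose_apply,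
      RingHom.mapMatrix_apply]
    simp only [actGL, RingHom.coe_coe, Fin.sum_univ_three]
    ring
  have h2 : (g.map C : Matrix (Fin 3) (Fin 3) (MvPolynomial (Fin 3) R)).det = C g.det :=
    (RingHom.map_det C g).symm
  rw [hess, h1, Matrix.det_mul, Matrix.det_mul, Matrix.det_transpose, ← RingHom.map_det, h2, hess,
    actGL]
  simp only [RingHom.coe_coe]
  ring

theorem hc_ac (g : Matrix (Fin 3) (Fin 3) R) (c : Fin 10 → R) :
    hc (ac g c) = g.det ^ 2 • ac g (hc c) := by
  apply cubic_inj
  rw [← hess_cubic, ← act_cubic, hess_act, hess_cubic, act_cubic]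
  simp [cubic, Finset.mul_sum, mul_assoc]

theorem hc_smul (a : R) (c : Fin 10 → R) : hc (a • c) = a ^ 3 • hc c := by
  ext k
  fin_cases k <;> simp [hc] <;> ring

theorem ac_lin (g : Matrix (Fin 3) (Fin 3) R) (a b : R) (c d : Fin 10 → R) :
    ac g (a • c + b • d) = a • ac g c + b • ac g d := by
  ext k
  fin_cases k <;> simp [ac, ev, dv, tv] <;> ring

theorem act_comp (g h : Matrix (Fin 3) (Fin 3) R) (f : MvPolynomial (Fin 3) R) :
    actGL h (actGL g f) = actGL (h * g) f := by
  simp only [actGL, bind₁_bind₁]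
  congr 2
  ext1 j
  simp [Fin.sum_univ_three, Matrix.mul_apply]
  ring

theorem ac_comp (g h : Matrix (Fin 3) (Fin 3) R) (c : Fin 10 → R) :
    ac h (ac g c) = ac (h * g) c := by
  apply cubic_inj
  simp only [← act_cubic, act_comp]

theorem ac_scalar (d : R) (c : Fin 10 → R) :
    ac (d • (1 : Matrix (Fin 3) (Fin 3) R)) c = d ^ 3 • c := by
  ext k
  fin_cases k <;> simp [ac, ev, dv, tv] <;> ring

theorem ac_one (c : Fin 10 → R) : ac (1 : Matrix (Fin 3) (Fin 3) R) c = c := by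
  simpa using ac_scalar 1 c

theorem map_ev {S : Type*} [CommRing S] (φ : R →+* S) (c : Fin 10 → R) (u : Fin 3 → R) :
    φ (ev c u) = ev (fun k => φ (c k)) (fun i => φ (u i)) := by simp [ev]

theorem map_ac {S : Type*} [CommRing S] (φ : R →+* S) (g : Matrix (Fin 3) (Fin 3) R)
    (c : Fin 10 → R) (k : Fin 10) :
    φ (ac g c k) = ac (g.map φ) (fun k => φ (c k)) k := by
  fin_cases k <;> simp [ac, ev, dv, tv, map_ofNat]

theorem map_hc {S : Type*} [CommRing S] (φ : R →+* S) 
    (c : Fin 10 → R) (k : Fin 10) :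
    φ (hc c k) = hc (fun k => φ (c k)) k := by
  fin_cases k <;> simp [hc, map_ofNat]

end Basic

section Invariants
set_option linter.unusedSimpArgs false

theorem cubic_lin {R : Type*} [CommRing R] (a b : R) (c d : Fin 10 → R) :
    C a * cubic c + C b * cubic d = cubic (fun k => a * c k + b * d k) := by
  simp only [cubic_expand, map_add, map_mul]
  ring

theorem inst_id {P Q : MvPolynomial (Fin 10) ℚ} (hPQ : IsInvariantPair ℚ P Q)
    {R : Type*} [CommRing R] [Algebra ℚ R] (c : Fin 10 → R) (k : Fin 10) :
    hc (hc c) k = 12288 * (aeval c P) ^ 2 * c k + 512 * (aeval c Q) * hc c k := by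
  have h := hPQ.2.2.1
  simp only [genCubic, hess_cubic] at h
  have e1 : (12288 * C P ^ 2 : MvPolynomial (Fin 3) (MvPolynomial (Fin 10) ℚ))
      = C (12288 * P ^ 2) := by simp only [map_mul, map_pow, map_ofNat]
  have e2 : (512 * C Q : MvPolynomial (Fin 3) (MvPolynomial (Fin 10) ℚ))
      = C (512 * Q) := by simp only [map_mul, map_ofNat]
  rw [e1, e2, cubic_lin] at h
  have h2 := congrFun (cubic_inj h) k
  have h3 := congrArg ((aeval c : MvPolynomial (Fin 10) ℚ →ₐ[ℚ] R) : _ →+* R) h2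
  simp only [map_hc, map_add, map_mul, map_pow, map_ofNat] at h3
  simpa using h3

theorem ac_inj {R : Type*} [CommRing R] [IsDomain R] (g : Matrix (Fin 3) (Fin 3) R)
    (hg : g.det ≠ 0) (c : Fin 10 → R) (h : ac g c = 0) : c = 0 := by
  have h1 : ac (g.adjugate) (ac g c) = g.det ^ 3 • c := by
    rw [ac_comp, Matrix.adjugate_mul, ac_scalar]
  rw [h] at h1
  have h2 : ac g.adjugate (0 : Fin 10 → R) = 0 := by
    simpa using ac_lin g.adjugate 0 0 (0 : Fin 10 → R) 0
  rw [h2] at h1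
  exact (smul_eq_zero.mp h1.symm).resolve_left (pow_ne_zero _ hg)

theorem inv_domain {P Q : MvPolynomial (Fin 10) ℚ} (hPQ : IsInvariantPair ℚ P Q)
    {R : Type*} [CommRing R] [IsDomain R] [Algebra ℚ R] (c : Fin 10 → R)
    (g : Matrix (Fin 3) (Fin 3) R) (hg : g.det ≠ 0) (i j : Fin 10)
    (hij : c i * hc c j - c j * hc c i ≠ 0) :
    (aeval (ac g c) P) ^ 2 = (g.det ^ 4 * aeval c P) ^ 2 ∧
    aeval (ac g c) Q = g.det ^ 6 * aeval c Q := by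
  have : CharZero R := algebraRat.charZero R
  have hc1 : hc (hc c) = (12288 * (aeval c P) ^ 2) • c + (512 * (aeval c Q)) • hc c := by
    ext k; simpa using inst_id hPQ c k
  have hc2 : hc (hc (ac g c)) = (12288 * (aeval (ac g c) P) ^ 2) • ac g c
      + (512 * (aeval (ac g c) Q)) • hc (ac g c) := by
    ext k; simpa using inst_id hPQ (ac g c) k
  rw [hc_ac, hc_smul, hc_ac, hc1, ac_lin] at hc2
  set I := aeval c P
  set J := aeval c Q
  set I' := aeval (ac g c) P
  set J' := aeval (ac g c) Q
  set D := g.det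
  have h0 : ac g ((12288 * (I' ^ 2 - D ^ 8 * I ^ 2)) • c + (512 * (J' * D ^ 2 - D ^ 8 * J)) • hc c)
      = 0 := by
    rw [ac_lin]
    ext k
    have := congrFun hc2 k
    simp only [Pi.add_apply, Pi.smul_apply, smul_eq_mul, Pi.zero_apply] at this ⊢
    linear_combination -this
  have h1 := ac_inj g hg _ h0
  have hi := congrFun h1 i
  have hj := congrFun h1 j
  simp only [Pi.add_apply, Pi.smul_apply, smul_eq_mul, Pi.zero_apply] at hi hj
  have k1 : 12288 * (I' ^ 2 - D ^ 8 * I ^ 2) * (c i * hc c j - c j * hc c i) = 0 := by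
    linear_combination hc c j * hi - hc c i * hj
  have k2 : 512 * D ^ 2 * (J' - D ^ 6 * J) * (c i * hc c j - c j * hc c i) = 0 := by
    linear_combination c i * hj - c j * hi
  have k3 := (mul_eq_zero.mp k1).resolve_right hij
  have k4 := (mul_eq_zero.mp k2).resolve_right hij
  have k5 := (mul_eq_zero.mp k3).resolve_left (by norm_num)
  have k6 := (mul_eq_zero.mp k4).resolve_left (mul_ne_zero (by norm_num) (pow_ne_zero _ hg))
  exact ⟨by linear_combination k5, by linear_combination k6⟩

/-- The generic ring in which a generic cubic and a generic matrix live. -/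
abbrev GR := MvPolynomial (Fin 10 ⊕ (Fin 3 × Fin 3)) ℚ

/-- Generic coefficients. -/
noncomputable def gcoef : Fin 10 → GR := fun k => X (Sum.inl k)

/-- Generic matrix. -/
noncomputable def gmat : Matrix (Fin 3) (Fin 3) GR := Matrix.of fun i j => X (Sum.inr (i, j))

/-- Specialization. -/
noncomputable def spec {K : Type*} [CommRing K] [Algebra ℚ K] (c : Fin 10 → K)
    (g : Matrix (Fin 3) (Fin 3) K) : GR →ₐ[ℚ] K :=
  aeval (Sum.elim c (fun p => g p.1 p.2))

theorem spec_c {K : Type*} [CommRing K] [Algebra ℚ K] (c : Fin 10 → K)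
    (g : Matrix (Fin 3) (Fin 3) K) (k : Fin 10) : spec c g (gcoef k) = c k := by
  simp [spec, gcoef]

theorem spec_g {K : Type*} [CommRing K] [Algebra ℚ K] (c : Fin 10 → K)
    (g : Matrix (Fin 3) (Fin 3) K) : gmat.map ((spec c g : GR →ₐ[ℚ] K) : GR →+* K) = g := by
  ext i j
  simp [spec, gmat]

theorem spec_det {K : Type*} [CommRing K] [Algebra ℚ K] (c : Fin 10 → K)
    (g : Matrix (Fin 3) (Fin 3) K) : spec c g gmat.det = g.det := by
  have := RingHom.map_det ((spec c g : GR →ₐ[ℚ] K) : GR →+* K) gmat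
  rw [RingHom.mapMatrix_apply, spec_g] at this
  exact this

theorem aeval_push (P : MvPolynomial (Fin 10) ℚ) {R K : Type*} [CommRing R] [CommRing K]
    [Algebra ℚ R] [Algebra ℚ K] (φ : R →ₐ[ℚ] K) (c : Fin 10 → R) :
    φ (aeval c P) = aeval (fun k => φ (c k)) P := by
  rw [← AlgHom.comp_apply, comp_aeval]

theorem spec_P {K : Type*} [CommRing K] [Algebra ℚ K] (c : Fin 10 → K)
    (g : Matrix (Fin 3) (Fin 3) K) (P : MvPolynomial (Fin 10) ℚ) :
    spec c g (aeval gcoef P) = aeval c P ∧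
    spec c g (aeval (ac gmat gcoef) P) = aeval (ac g c) P := by
  constructor
  · rw [aeval_push]
    simp only [spec_c]
  · rw [aeval_push]
    congr 2
    ext1 k
    have := map_ac ((spec c g : GR →ₐ[ℚ] K) : GR →+* K) gmat gcoef k
    rw [spec_g] at this
    simpa [spec_c] using this

theorem inv_gen {P Q : MvPolynomial (Fin 10) ℚ} (hPQ : IsInvariantPair ℚ P Q)
    {K : Type*} [CommRing K] [Algebra ℚ K] (c : Fin 10 → K) (g : Matrix (Fin 3) (Fin 3) K) :
    aeval (ac g c) P = g.det ^ 4 * aeval c P ∧ aeval (ac g c) Q = g.det ^ 6 * aeval c Q := by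
  have hd : gmat.det ≠ 0 := by
    intro h
    have := spec_det (0 : Fin 10 → ℚ) 1
    rw [h] at this
    simp at this
  have hm : gcoef 0 * hc gcoef 4 - gcoef 4 * hc gcoef 0 ≠ 0 := by
    intro h
    have := congrArg ((spec (wcoeffs (1 : ℚ) 0) 1 : GR →ₐ[ℚ] ℚ) : GR →+* ℚ) h
    rw [map_sub, map_mul, map_mul, map_hc, map_hc] at this
    simp [spec_c, wcoeffs, hc] at this
  obtain ⟨h1, h2⟩ := inv_domain hPQ gcoef gmat hd 0 4 hm
  have h3 : aeval (ac gmat gcoef) P = gmat.det ^ 4 * aeval gcoef P := by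
    rcases sq_eq_sq_iff_eq_or_eq_neg.mp h1 with h | h
    · exact h
    · exfalso
      have := congrArg (spec (wcoeffs (1 : ℚ) 0) 1) h
      rw [(spec_P _ _ P).2, map_neg, map_mul, map_pow, spec_det, (spec_P _ _ P).1, ac_one,
        (hPQ.2.2.2 1 0).1] at this
      norm_num at this
  constructor
  · have := congrArg (spec c g) h3
    rwa [(spec_P _ _ P).2, map_mul, map_pow, spec_det, (spec_P _ _ P).1] at this
  · have := congrArg (spec c g) h2
    rwa [(spec_P _ _ Q).2, map_mul, map_pow, spec_det, (spec_P _ _ Q).1] at this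

/-- Cyclically invariant cubic forms. -/
def cyc {R : Type*} (a b c d : R) : Fin 10 → R := ![a, a, a, b, c, c, b, b, c, d]

/-- The invariant `I` on the cyclic family, times 16. -/
def cycI {R : Type*} [CommRing R] (a b c d : R) : R :=
  -(216 * a^3*d - 432*a^2*b*c + 144*a*b^3 - 72*a*b*c*d + 144*a*c^3 - 24*b^3*d
    + 24*b*c*d^2 - 24*c^3*d - d^4)

/-- The invariant `J` on the cyclic family, times 32. -/
def cycJ {R : Type*} [CommRing R] (a b c d : R) : R :=
  5832*a^6 - 11664*a^4*b*c + 3888*a^3*b^3 + 3888*a^3*b*c*d + 3888*a^3*c^3 - 540*a^3*d^3 - 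
    2592*a^2*b^3*d - 1944*a^2*b^2*c^2 + 1944*a^2*b*c*d^2 - 2592*a^2*c^3*d + 1296*a*b^4*c + 
    216*a*b^3*d^2 - 1296*a*b^2*c^2*d + 1296*a*b*c^4 - 108*a*b*c*d^3 + 216*a*c^3*d^2 - 216*b^6 
    + 432*b^4*c*d - 432*b^3*c^3 - 36*b^3*d^3 - 216*b^2*c^2*d^2 + 432*b*c^4*d + 36*b*c*d^4 - 
    216*c^6 - 36*c^3*d^3 - 1*d^6

theorem map_cycI {R S : Type*} [CommRing R] [CommRing S] (φ : R →+* S) (a b c d : R) :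
    φ (cycI a b c d) = cycI (φ a) (φ b) (φ c) (φ d) := by
  simp [cycI, map_ofNat]

theorem map_cycJ {R S : Type*} [CommRing R] [CommRing S] (φ : R →+* S) (a b c d : R) :
    φ (cycJ a b c d) = cycJ (φ a) (φ b) (φ c) (φ d) := by
  simp [cycJ, map_ofNat]

theorem hc_cyc {R : Type*} [CommRing R] (a b c d : R) : hc (cyc a b c d) =
    cyc (24*a*b*c - 6*a*d^2 - 8*b^3 + 8*b*c*d - 8*c^3) (2*b*(6*a-d)^2) (2*c*(6*a-d)^2)
      (216*a^3 - 72*a*b*c + 24*b^3 - 24*b*c*d + 24*c^3 + 2*d^3) := by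
  ext k
  fin_cases k <;> simp [hc, cyc] <;> ring

theorem cyc_domain {P Q : MvPolynomial (Fin 10) ℚ} (hPQ : IsInvariantPair ℚ P Q)
    {R : Type*} [CommRing R] [IsDomain R] [Algebra ℚ R] (a b c d : R)
    (hne : a * (2*b*(6*a-d)^2) - b * (24*a*b*c - 6*a*d^2 - 8*b^3 + 8*b*c*d - 8*c^3) ≠ 0) :
    (16 * aeval (cyc a b c d) P) ^ 2 = (cycI a b c d) ^ 2 ∧
    32 * aeval (cyc a b c d) Q = cycJ a b c d := by
  have : CharZero R := algebraRat.charZero R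
  have h0 := inst_id hPQ (cyc a b c d) 0
  have h3 := inst_id hPQ (cyc a b c d) 3
  rw [hc_cyc, hc_cyc] at h0 h3
  simp only [cyc, Matrix.cons_val] at h0 h3
  change _ = 12288 * (aeval (cyc a b c d) P) ^ 2 * _ + 512 * aeval (cyc a b c d) Q * _ at h0
  change _ = 12288 * (aeval (cyc a b c d) P) ^ 2 * _ + 512 * aeval (cyc a b c d) Q * _ at h3
  set I := aeval (cyc a b c d) P
  set J := aeval (cyc a b c d) Q
  constructor
  · rw [← sub_eq_zero]
    refine (mul_eq_zero.mp ?_).resolve_right hne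
    refine (mul_eq_zero.mp (?_ : (48 : R) * _ = 0)).resolve_left (by norm_num)
    rw [cycI]
    linear_combination -(2*b*(6*a-d)^2) * h0
      + (24*a*b*c - 6*a*d^2 - 8*b^3 + 8*b*c*d - 8*c^3) * h3
  · rw [← sub_eq_zero]
    refine (mul_eq_zero.mp ?_).resolve_right hne
    refine (mul_eq_zero.mp (?_ : (16 : R) * _ = 0)).resolve_left (by norm_num)
    rw [cycJ]
    linear_combination -a * h3 + b * h0

theorem cyc_sample : ac (!![3/4, 1, -3; 3/4, -1, -3; 5/4, 0, 3] : Matrix (Fin 3) (Fin 3) ℚ)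
    (wcoeffs (7/48) (13/864)) = cyc 4 0 0 12 := by
  simp only [ac, ev, dv, tv, wcoeffs, cyc, Matrix.of_apply, Matrix.cons_val]
  norm_num

theorem cyc_key {L : Type*} [CommRing L] [Algebra ℚ L] (v : Fin 4 → L)
    (F : MvPolynomial (Fin 10) ℚ) :
    (aeval v : MvPolynomial (Fin 4) ℚ →ₐ[ℚ] L)
      (aeval (cyc (X 0 : MvPolynomial (Fin 4) ℚ) (X 1) (X 2) (X 3)) F)
        = aeval (cyc (v 0) (v 1) (v 2) (v 3)) F := by
  rw [aeval_push]
  congr 2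
  ext1 k
  fin_cases k <;> simp [cyc]

/-- Values of the invariants on the cyclic family. -/
theorem cyc_inv {P Q : MvPolynomial (Fin 10) ℚ} (hPQ : IsInvariantPair ℚ P Q)
    {K : Type*} [CommRing K] [Algebra ℚ K] (a b c d : K) :
    16 * aeval (cyc a b c d) P = cycI a b c d ∧ 32 * aeval (cyc a b c d) Q = cycJ a b c d := by
  have hne : (X 0 : MvPolynomial (Fin 4) ℚ) * (2*X 1*(6*X 0-X 3)^2) - X 1 * (24*X 0*X 1*X 2 - 6*X 0*X 3^2 - 8*X 1^3 + 8*X 1*X 2*X 3 - 8*X 2^3) ≠ 0 := by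
    intro h
    have := congrArg (aeval (![0, 1, 0, 0] : Fin 4 → ℚ)) h
    simp at this
  obtain ⟨h1, h2⟩ := cyc_domain hPQ (X 0 : MvPolynomial (Fin 4) ℚ) (X 1) (X 2) (X 3) hne
  have h3 : 16 * aeval (cyc (X 0 : MvPolynomial (Fin 4) ℚ) (X 1) (X 2) (X 3)) P
      = cycI (X 0) (X 1) (X 2) (X 3) := by
    rcases sq_eq_sq_iff_eq_or_eq_neg.mp h1 with h | h
    · exact h
    · exfalso
      have h4 := congrArg (aeval (![4, 0, 0, 12] : Fin 4 → ℚ)) h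
      rw [map_mul, cyc_key, map_neg] at h4
      have h5 := (inv_gen hPQ (wcoeffs (7/48 : ℚ) (13/864))
        (!![3/4, 1, -3; 3/4, -1, -3; 5/4, 0, 3] : Matrix (Fin 3) (Fin 3) ℚ)).1
      rw [cyc_sample, (hPQ.2.2.2 _ _).1, Matrix.det_fin_three] at h5
      simp only [Matrix.cons_val] at h4
      rw [h5] at h4
      simp [cycI, map_ofNat] at h4
      norm_num at h4
  set v : Fin 4 → K := ![a, b, c, d]
  constructor
  · have := congrArg ((aeval v : MvPolynomial (Fin 4) ℚ →ₐ[ℚ] K) : _ →+* K) h3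
    rw [map_mul, map_cycI, RingHom.coe_coe, cyc_key] at this
    simpa [v] using this
  · have := congrArg ((aeval v : MvPolynomial (Fin 4) ℚ →ₐ[ℚ] K) : _ →+* K) h2
    rw [map_mul, map_cycJ, RingHom.coe_coe, cyc_key] at this
    simpa [v] using this

end Invariants

section LinAlg
set_option linter.unusedSimpArgs false

theorem ev_ac {R : Type*} [CommRing R] (g : Matrix (Fin 3) (Fin 3) R) (c : Fin 10 → R)
    (u : Fin 3 → R) : ev (ac g c) u = ev c (Matrix.vecMul u g) := by
  have h := congrArg (eval₂ (RingHom.id R) u) (act_cubic g c)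
  rw [aeval_cubic] at h
  simp only [RingHom.id_apply] at h
  rw [← h, cubic_expand]
  have key : ∀ j, eval₂ (RingHom.id R) u (∑ i : Fin 3, C (g i j) * X i) = Matrix.vecMul u g j := by
    intro j
    simp [Matrix.vecMul, dotProduct, Fin.sum_univ_three, mul_comm]
  simp only [actGL, map_add, map_mul, map_pow, bind₁_X_right, bind₁_C_right]
  simp only [eval₂_add, eval₂_mul, eval₂_pow, eval₂_C, key, ev, RingHom.id_apply]

theorem tv_polar {R : Type*} [CommRing R] (c : Fin 10 → R) (u v w : Fin 3 → R) :
    tv c u v w = ev c (u + v + w) - ev c (u + v) - ev c (u + w) - ev c (v + w)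
      + ev c u + ev c v + ev c w := by
  simp only [tv, ev, Pi.add_apply]
  ring

theorem tv_ac {R : Type*} [CommRing R] (g : Matrix (Fin 3) (Fin 3) R) (c : Fin 10 → R)
    (u v w : Fin 3 → R) : tv (ac g c) u v w
      = tv c (Matrix.vecMul u g) (Matrix.vecMul v g) (Matrix.vecMul w g) := by
  simp only [tv_polar, ev_ac, Matrix.add_vecMul]

theorem tv_ev {R : Type*} [CommRing R] (c : Fin 10 → R) (u : Fin 3 → R) :
    tv c u u u = 6 * ev c u := by
  simp only [tv, ev]; ring

theorem tv_dv {R : Type*} [CommRing R] (c : Fin 10 → R) (u v : Fin 3 → R) :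
    tv c u u v = 2 * dv c u v := by
  simp only [tv, dv]; ring

theorem tv_swap {R : Type*} [CommRing R] (c : Fin 10 → R) (u v w : Fin 3 → R) :
    tv c u v w = tv c v u w := by
  simp only [tv]; ring

theorem tv_rot {R : Type*} [CommRing R] (c : Fin 10 → R) (u v w : Fin 3 → R) :
    tv c u v w = tv c v w u := by
  simp only [tv]; ring

theorem tv_add {R : Type*} [CommRing R] (c : Fin 10 → R) (u v w x : Fin 3 → R) :
    tv c u v (w + x) = tv c u v w + tv c u v x := by
  simp only [tv, Pi.add_apply]; ring

theorem tv_smul {R : Type*} [CommRing R] (c : Fin 10 → R) (a : R) (u v w : Fin 3 → R) :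
    tv c u v (a • w) = a * tv c u v w := by
  simp only [tv, Pi.smul_apply, smul_eq_mul]; ring

/-- No rational flexes. -/
def NoFlex (c : Fin 10 → ℚ) : Prop :=
  ∀ v : Fin 3 → ℚ, v ≠ 0 → ev c v = 0 → ev (hc c) v = 0 → False

theorem noFlex_of {c : Fin 10 → ℤ} (h : StronglyIrred c) : NoFlex (fun k => (c k : ℚ)) := by
  intro v hv h1 h2
  refine h ⟨v, hv, ?_, ?_⟩
  · rw [eval, coe_eval₂Hom, aeval_cubic]; exact h1
  · rw [hess_cubic, eval, coe_eval₂Hom, aeval_cubic]; exact h2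

theorem flex1 {c : Fin 10 → ℚ} (hc0 : NoFlex c) (u d : Fin 3 → ℚ) (hu : u ≠ 0)
    (hd : ∀ a : ℚ, a • u ≠ d) (h1 : tv c u u u = 0) (h2 : tv c u u d = 0)
    (h3 : tv c d d u = 0) : False := by
  have hli : LinearIndependent ℚ ![u, d] := (LinearIndependent.pair_iff' hu).2 hd
  have hx := crossProduct_ne_zero_iff_linearIndependent.2 hli
  set x := crossProduct u d with hxdef
  have hdet : (Matrix.of ![u, d, x]).det = x 0 ^ 2 + x 1 ^ 2 + x 2 ^ 2 := by
    rw [Matrix.det_fin_three]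
    simp [hxdef, cross_apply]
    ring
  have hdet0 : (Matrix.of ![u, d, x]).det ≠ 0 := by
    rw [hdet]
    intro h
    apply hx
    ext i
    have a0 := sq_nonneg (x 0)
    have a1 := sq_nonneg (x 1)
    have a2 := sq_nonneg (x 2)
    fin_cases i <;> simp <;> apply pow_eq_zero_iff (two_ne_zero) |>.1 <;> linarith
  have key := congrFun (hc_ac (Matrix.of ![u, d, x]) c) 0
  have e0 : ev c u = 0 := by rw [tv_ev] at h1; linarith
  have e3 : dv c u d = 0 := by rw [tv_dv] at h2; linarith
  have e5 : dv c d u = 0 := by rw [tv_dv] at h3; linarith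
  have r0 : Matrix.of ![u, d, x] 0 = u := rfl
  have r1 : Matrix.of ![u, d, x] 1 = d := rfl
  have hz : hc (ac (Matrix.of ![u, d, x]) c) 0 = 0 := by
    simp [hc, ac, r0, r1, e0, e3, e5]
  rw [hz] at key
  simp only [Pi.smul_apply, smul_eq_mul] at key
  have k2 := (mul_eq_zero.1 key.symm).resolve_left (pow_ne_zero _ hdet0)
  exact hc0 u hu e0 (by simpa [ac, r0] using k2)

variable {c : Fin 10 → ℚ} {M : Matrix (Fin 3) (Fin 3) ℚ}

theorem tv_inv {K : Type*} [CommRing K] {c : Fin 10 → K} {M : Matrix (Fin 3) (Fin 3) K}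
    (hM : ac M c = c) (u v w : Fin 3 → K) :
    tv c (Matrix.vecMul u M) (Matrix.vecMul v M) (Matrix.vecMul w M) = tv c u v w := by
  conv_rhs => rw [← hM]
  rw [tv_ac]

theorem flex2 (hc0 : NoFlex c) (hM : ac M c = c) (hdet : M.det = 1) (v : Fin 3 → ℚ) (hv : v ≠ 0)
    (h : Matrix.vecMul v M = -v) : False := by
  have neg : ∀ d : Fin 10 → ℚ, ev d (-v) = - ev d v := by
    intro d; simp only [ev, Pi.neg_apply]; ring
  have h1 : ev c (Matrix.vecMul v M) = ev c v := by
    conv_rhs => rw [← hM]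
    rw [ev_ac]
  have h2 : ev (hc c) (Matrix.vecMul v M) = ev (hc c) v := by
    have := hc_ac M c
    rw [hM, hdet, one_pow, one_smul] at this
    conv_rhs => rw [this]
    rw [ev_ac]
  rw [h, neg] at h1 h2
  exact hc0 v hv (by linarith) (by linarith)

theorem flex3 (hc0 : NoFlex c) (hM : ac M c = c) (w u : Fin 3 → ℚ) (hu : u ≠ 0)
    (h1 : Matrix.vecMul w M = w + u) (h2 : Matrix.vecMul u M = u) : False := by
  have i1 := tv_inv hM u u w
  have i2 := tv_inv hM w w u
  have i3 := tv_inv hM w w w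
  rw [h1, h2, tv_add] at i1
  rw [h1, h2] at i2
  rw [h1] at i3
  have j1 : tv c u u u = 0 := by linarith
  have j2 : tv c (w + u) (w + u) u = tv c w w u + 2 * tv c u u w + tv c u u u := by
    simp only [tv, Pi.add_apply]; ring
  have j3 : tv c (w + u) (w + u) (w + u)
      = tv c w w w + 3 * tv c w w u + 3 * tv c u u w + tv c u u u := by
    simp only [tv, Pi.add_apply]; ring
  refine flex1 hc0 u w hu ?_ j1 (by linarith) (by linarith)
  intro a ha
  rw [← ha, Matrix.smul_vecMul, h2] at h1
  exact hu (by simpa using h1)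

/-- Sum of the principal minors. -/
def mns {K : Type*} [CommRing K] (M : Matrix (Fin 3) (Fin 3) K) : K :=
  M 0 0 * M 1 1 - M 0 1 * M 1 0 + M 0 0 * M 2 2 - M 0 2 * M 2 0 + M 1 1 * M 2 2 - M 1 2 * M 2 1

theorem ch {K : Type*} [CommRing K] (M : Matrix (Fin 3) (Fin 3) K) (hdet : M.det = 1)
    (u : Fin 3 → K) :
    Matrix.vecMul (Matrix.vecMul (Matrix.vecMul u M) M) M
      = M.trace • Matrix.vecMul (Matrix.vecMul u M) M - mns M • Matrix.vecMul u M + u := by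
  rw [Matrix.det_fin_three] at hdet
  ext i
  fin_cases i <;>
    simp [Matrix.vecMul, dotProduct, Fin.sum_univ_three, Matrix.trace, mns, Matrix.mul_apply]
  · linear_combination (u 0) * hdet
  · linear_combination (u 1) * hdet
  · linear_combination (u 2) * hdet

theorem eig {K : Type*} [Field K] (M : Matrix (Fin 3) (Fin 3) K) (hdet : M.det = 1) (a : K)
    (h : a ^ 3 - M.trace * a ^ 2 + mns M * a - 1 = 0) :
    ∃ u : Fin 3 → K, u ≠ 0 ∧ Matrix.vecMul u M = a • u := by
  have : (M - a • (1 : Matrix (Fin 3) (Fin 3) K)).det = 0 := by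
    rw [Matrix.det_fin_three] at hdet ⊢
    simp [Matrix.trace, mns, Fin.sum_univ_three] at h ⊢
    linear_combination hdet - h
  obtain ⟨u, hu, h2⟩ := Matrix.exists_vecMul_eq_zero_iff.2 this
  refine ⟨u, hu, ?_⟩
  rw [Matrix.vecMul_sub, Matrix.vecMul_smul, Matrix.vecMul_one] at h2
  exact sub_eq_zero.1 h2

theorem rat_root (t s : ℤ) (x : ℚ) (h : x ^ 3 - t * x ^ 2 + s * x - 1 = 0) : x = 1 ∨ x = -1 := by
  have hd : (x.den : ℚ) ≠ 0 := by exact_mod_cast x.den_nz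
  have hx : x * x.den = x.num := Rat.mul_den_eq_num x
  have e : (x.num : ℚ) ^ 3 - t * x.num ^ 2 * x.den + s * x.num * x.den ^ 2 - x.den ^ 3 = 0 := by
    rw [← hx]; linear_combination (x.den : ℚ) ^ 3 * h
  have e' : (x.num : ℤ) ^ 3 - t * x.num ^ 2 * x.den + s * x.num * x.den ^ 2 - x.den ^ 3 = 0 := by
    exact_mod_cast e
  have cop : IsCoprime x.num (x.den : ℤ) := by
    rw [Int.isCoprime_iff_nat_coprime]; simpa using x.reduced
  have d1 : x.num ∣ (x.den : ℤ) ^ 3 :=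
    ⟨x.num ^ 2 - t * x.num * x.den + s * x.den ^ 2, by linear_combination -e'⟩
  have d2 : (x.den : ℤ) ∣ x.num ^ 3 :=
    ⟨t * x.num ^ 2 - s * x.num * x.den + x.den ^ 2, by linear_combination e'⟩
  have u1 : IsUnit x.num := (cop.pow_right (n := 3)).isUnit_of_dvd' dvd_rfl d1
  have u2 : IsUnit (x.den : ℤ) := (cop.pow_left (m := 3)).symm.isUnit_of_dvd' dvd_rfl d2
  have u3 : x.den = 1 := by
    have := Int.isUnit_iff.1 u2
    omega
  rw [u3] at hx
  rcases Int.isUnit_iff.1 u1 with h | h <;> rw [h] at hx <;> simp at hx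
  · exact Or.inl hx
  · exact Or.inr hx

end LinAlg

section Cases
set_option linter.unusedSimpArgs false
open scoped Matrix

theorem case_gen {c : Fin 10 → ℚ} {M : Matrix (Fin 3) (Fin 3) ℚ} (hc0 : NoFlex c)
    (hM : ac M c = c) (m : ℚ) (p : Fin 3 → ℚ) (hp0 : p ≠ 0)
    (hp : (p ᵥ* M) ᵥ* M = m • (p ᵥ* M) - p) (h1 : m + 1 ≠ 0) (h2 : m - 2 ≠ 0)
    (hr : ∀ a : ℚ, a ^ 2 - m * a + 1 ≠ 0) : False := by
  have i1 := tv_inv hM p p (p ᵥ* M)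
  have i2 := tv_inv hM (p ᵥ* M) (p ᵥ* M) p
  have i3 := tv_inv hM (p ᵥ* M) (p ᵥ* M) (p ᵥ* M)
  have i4 := tv_inv hM p p p
  rw [hp] at i1 i2 i3
  set q := p ᵥ* M with hq
  have j1 : tv c q q (m • q - p) = m * tv c q q q - tv c q q p := by
    simp only [tv, Pi.sub_apply, Pi.smul_apply, smul_eq_mul]; ring
  have j2 : tv c (m • q - p) (m • q - p) q
      = m ^ 2 * tv c q q q - 2 * m * tv c q q p + tv c p p q := by
    simp only [tv, Pi.sub_apply, Pi.smul_apply, smul_eq_mul]; ring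
  have j3 : tv c (m • q - p) (m • q - p) (m • q - p)
      = m ^ 3 * tv c q q q - 3 * m ^ 2 * tv c q q p + 3 * m * tv c p p q - tv c p p p := by
    simp only [tv, Pi.sub_apply, Pi.smul_apply, smul_eq_mul]; ring
  rw [j1] at i1
  rw [j2] at i2
  rw [j3] at i3
  set A := tv c p p p
  set A' := tv c q q q
  set B := tv c p p q
  set D := tv c q q p
  have k1 : (m + 1) * (2 * D - m * A) = 0 := by
    linear_combination -i2 - i1 + (m ^ 2 + m) * i4
  have k2 : 2 * D = m * A := by
    have := (mul_eq_zero.1 k1).resolve_left h1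
    linarith
  have k3 : A * ((m + 1) * (m - 2) ^ 2) = 0 := by
    linear_combination -2 * i3 - 6 * m * i1 + (2 * m ^ 3 + 6 * m ^ 2 - 2 ) * i4 - 3 * (m ^ 2 + m) * k2
  have kA : A = 0 := (mul_eq_zero.1 k3).resolve_right (mul_ne_zero h1 (pow_ne_zero _ h2))
  have kD : D = 0 := by rw [kA] at k2; linarith
  have kB : B = 0 := by rw [← i1, i4, kA, kD]; ring
  refine flex1 hc0 p q hp0 ?_ kA kB kD
  intro a ha
  apply hr a
  have hq2 : q ᵥ* M = a • q := by rw [← ha, Matrix.smul_vecMul, ← hq, ha]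
  rw [hq2, ← ha] at hp
  have : (a ^ 2 - m * a + 1) • p = 0 := by
    ext i
    have := congrFun hp i
    simp [-mul_eq_zero] at this ⊢
    linear_combination this
  exact (smul_eq_zero.1 this).resolve_right hp0

/-- A form with an automorphism of order three is equivalent to a cyclic form. -/
theorem case_three {c : Fin 10 → ℚ} {M : Matrix (Fin 3) (Fin 3) ℚ}
    (hM : ac M c = c) (u p : Fin 3 → ℚ) (hu0 : u ≠ 0) (hu : u ᵥ* M = u) (hp0 : p ≠ 0)
    (hp : (p ᵥ* M) ᵥ* M = - (p ᵥ* M) - p) :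
    ∃ (G : Matrix (Fin 3) (Fin 3) ℚ) (a b d e : ℚ), G.det ≠ 0 ∧ ac G c = cyc a b d e := by
  have hp3 : ((p ᵥ* M) ᵥ* M) ᵥ* M = p := by
    rw [hp, Matrix.sub_vecMul, Matrix.neg_vecMul, hp]; simp
  obtain ⟨v, hv⟩ : ∃ v, v = u + p := ⟨_, rfl⟩
  have hv3 : ((v ᵥ* M) ᵥ* M) ᵥ* M = v := by
    rw [hv, Matrix.add_vecMul, Matrix.add_vecMul, Matrix.add_vecMul, hp3, hu, hu, hu]
  have t0 : ∀ x y z, tv c (x ᵥ* M) (y ᵥ* M) (z ᵥ* M) = tv c x y z := tv_inv hM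
  have e0 : ∀ x, ev c (x ᵥ* M) = ev c x := by
    intro x
    have := t0 x x x
    rw [tv_ev, tv_ev] at this
    linarith
  have d0 : ∀ x y, dv c (x ᵥ* M) (y ᵥ* M) = dv c x y := by
    intro x y
    have := t0 x x y
    rw [tv_dv, tv_dv] at this
    linarith
  refine ⟨Matrix.of ![v, v ᵥ* M, (v ᵥ* M) ᵥ* M], ev c v, dv c v (v ᵥ* M),
    dv c v ((v ᵥ* M) ᵥ* M), tv c v (v ᵥ* M) ((v ᵥ* M) ᵥ* M), ?_, ?_⟩
  · intro hdet
    obtain ⟨x, hx0, hx⟩ := Matrix.exists_vecMul_eq_zero_iff.2 hdet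
    have hx1 : x 0 • v + x 1 • (v ᵥ* M) + x 2 • ((v ᵥ* M) ᵥ* M) = 0 := by
      rw [← hx]
      ext i
      simp only [Matrix.vecMul, dotProduct, Fin.sum_univ_three, Pi.add_apply, Pi.smul_apply,
        smul_eq_mul, Matrix.of_apply, Matrix.cons_val]
    rw [hv] at hx1
    simp only [Matrix.add_vecMul, hu, hp] at hx1
    have hx2 := congrArg (fun z => z ᵥ* M) hx1
    simp only [Matrix.add_vecMul, Matrix.sub_vecMul, Matrix.neg_vecMul, Matrix.smul_vecMul, hu, hp,
      Matrix.zero_vecMul] at hx2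
    have hx3 := congrArg (fun z => z ᵥ* M) hx2
    simp only [Matrix.add_vecMul, Matrix.sub_vecMul, Matrix.neg_vecMul, Matrix.smul_vecMul, hu, hp,
      Matrix.zero_vecMul] at hx3
    set q := p ᵥ* M with hq
    have s1 : (3 * (x 0 + x 1 + x 2)) • u = 0 := by
      ext i
      have a1 := congrFun hx1 i
      have a2 := congrFun hx2 i
      have a3 := congrFun hx3 i
      simp [-mul_eq_zero] at a1 a2 a3 ⊢
      linear_combination a1 + a2 + a3
    have s2 : x 0 + x 1 + x 2 = 0 := by
      have := (smul_eq_zero.1 s1).resolve_right hu0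
      linarith
    have s3 : (x 0 - x 2) • p + (x 1 - x 2) • q = 0 := by
      ext i
      have a1 := congrFun hx1 i
      simp at a1 ⊢
      linear_combination a1 - u i * s2
    have hli : ∀ a : ℚ, a • p ≠ q := by
      intro a ha
      have hq2 : q ᵥ* M = a • q := by rw [← ha, Matrix.smul_vecMul, ← hq, ha]
      rw [hq2, ← ha] at hp
      have : (a ^ 2 + a + 1) • p = 0 := by
        ext i
        have := congrFun hp i
        simp [-mul_eq_zero] at this ⊢
        linear_combination this
      have := (smul_eq_zero.1 this).resolve_right hp0
      nlinarith [sq_nonneg (a + 1 / 2)]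
    have hl : LinearIndependent ℚ ![p, q] := (LinearIndependent.pair_iff' hp0).2 hli
    have s4 := LinearIndependent.pair_iff.1 hl _ _ s3
    apply hx0
    ext i
    fin_cases i <;> simp <;> linarith [s4.1, s4.2]
  · have f1 : dv c (v ᵥ* M) v = dv c v ((v ᵥ* M) ᵥ* M) := by
      rw [← d0, ← d0 _ (v ᵥ* M), hv3] 
    have f2 : dv c ((v ᵥ* M) ᵥ* M) v = dv c v (v ᵥ* M) := by
      rw [← d0, hv3]
    have f3 : dv c ((v ᵥ* M) ᵥ* M) (v ᵥ* M) = dv c v ((v ᵥ* M) ᵥ* M) := by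
      rw [d0, f1]
    have r0 : Matrix.of ![v, v ᵥ* M, (v ᵥ* M) ᵥ* M] 0 = v := rfl
    have r1 : Matrix.of ![v, v ᵥ* M, (v ᵥ* M) ᵥ* M] 1 = v ᵥ* M := rfl
    have r2 : Matrix.of ![v, v ᵥ* M, (v ᵥ* M) ᵥ* M] 2 = (v ᵥ* M) ᵥ* M := rfl
    simp only [ac, r0, r1, r2, f1, f2, f3, d0, e0, cyc]

/-- Distinct eigenvalues. -/
theorem case_diag {c : Fin 10 → ℂ} {M : Matrix (Fin 3) (Fin 3) ℂ} (hM : ac M c = c)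
    (a b d : ℂ) (hab : a ≠ b) (had : a ≠ d) (hbd : b ≠ d) (hprod : a * b * d = 1)
    (ha : a ^ 3 ≠ 1) (hb : b ^ 3 ≠ 1) (hd : d ^ 3 ≠ 1)
    (u v w : Fin 3 → ℂ) (hu0 : u ≠ 0) (hv0 : v ≠ 0) (hw0 : w ≠ 0)
    (hu : u ᵥ* M = a • u) (hv : v ᵥ* M = b • v) (hw : w ᵥ* M = d • w) :
    ∃ (G : Matrix (Fin 3) (Fin 3) ℂ) (e : ℂ), G.det ≠ 0 ∧ ac G c = cyc 0 0 0 e := by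
  have a0 : a ≠ 0 := by rintro rfl; simp at hprod
  have b0 : b ≠ 0 := by rintro rfl; simp at hprod
  have d0 : d ≠ 0 := by rintro rfl; simp at hprod
  have tz : ∀ (x y : ℂ) (z t : Fin 3 → ℂ), z ᵥ* M = x • z → t ᵥ* M = y • t → x ^ 2 * y ≠ 1 →
      tv c z z t = 0 := by
    intro x y z t hz ht hne
    have := tv_inv hM z z t
    rw [hz, ht] at this
    have e : tv c (x • z) (x • z) (y • t) = x ^ 2 * y * tv c z z t := by
      simp only [tv, Pi.smul_apply, smul_eq_mul]; ring
    rw [e] at this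
    have : (x ^ 2 * y - 1) * tv c z z t = 0 := by linear_combination this
    exact (mul_eq_zero.1 this).resolve_left (sub_ne_zero.2 hne)
  have dz : ∀ (x y : ℂ) (z t : Fin 3 → ℂ), z ᵥ* M = x • z → t ᵥ* M = y • t → x ^ 2 * y ≠ 1 →
      dv c z t = 0 := by
    intro x y z t hz ht hne
    have := tz x y z t hz ht hne
    rw [tv_dv] at this
    simpa using this
  have ez : ∀ (x : ℂ) (z : Fin 3 → ℂ), z ᵥ* M = x • z → x ^ 3 ≠ 1 → ev c z = 0 := by
    intro x z hz hne
    have := tz x x z z hz hz (by rwa [← pow_succ])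
    rw [tv_ev] at this
    simpa using this
  have pz : ∀ x y z : ℂ, x * y * z = 1 → x ≠ z → x ^ 2 * y ≠ 1 := by
    intro x y z h hne h2
    have hx : x * y ≠ 0 := by intro h0; rw [h0] at h; simp at h
    have : x * y * (x - z) = 0 := by linear_combination h2 - h
    exact hne (sub_eq_zero.1 ((mul_eq_zero.1 this).resolve_left hx))
  refine ⟨Matrix.of ![u, v, w], tv c u v w, ?_, ?_⟩
  · intro hdet
    obtain ⟨x, hx0, hx⟩ := Matrix.exists_vecMul_eq_zero_iff.2 hdet
    have hx1 : x 0 • u + x 1 • v + x 2 • w = 0 := by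
      rw [← hx]
      ext i
      simp only [Matrix.vecMul, dotProduct, Fin.sum_univ_three, Pi.add_apply, Pi.smul_apply,
        smul_eq_mul, Matrix.of_apply, Matrix.cons_val]
    have hx2 := congrArg (fun z => z ᵥ* M) hx1
    simp only [Matrix.add_vecMul, Matrix.smul_vecMul, hu, hv, hw, Matrix.zero_vecMul] at hx2
    have hx3 := congrArg (fun z => z ᵥ* M) hx2
    simp only [Matrix.add_vecMul, Matrix.smul_vecMul, hu, hv, hw, Matrix.zero_vecMul] at hx3
    have y0 : (x 0 * ((a - b) * (a - d))) • u = 0 := by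
      ext i
      have a1 := congrFun hx1 i
      have a2 := congrFun hx2 i
      have a3 := congrFun hx3 i
      simp [-mul_eq_zero] at a1 a2 a3 ⊢
      linear_combination a3 - (b + d) * a2 + b * d * a1
    have y1 : (x 1 * ((b - a) * (b - d))) • v = 0 := by
      ext i
      have a1 := congrFun hx1 i
      have a2 := congrFun hx2 i
      have a3 := congrFun hx3 i
      simp [-mul_eq_zero] at a1 a2 a3 ⊢
      linear_combination a3 - (a + d) * a2 + a * d * a1
    have y2 : (x 2 * ((d - a) * (d - b))) • w = 0 := by
      ext i
      have a1 := congrFun hx1 i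
      have a2 := congrFun hx2 i
      have a3 := congrFun hx3 i
      simp [-mul_eq_zero] at a1 a2 a3 ⊢
      linear_combination a3 - (a + b) * a2 + a * b * a1
    have z0 := (mul_eq_zero.1 ((smul_eq_zero.1 y0).resolve_right hu0)).resolve_right
      (mul_ne_zero (sub_ne_zero.2 hab) (sub_ne_zero.2 had))
    have z1 := (mul_eq_zero.1 ((smul_eq_zero.1 y1).resolve_right hv0)).resolve_right
      (mul_ne_zero (sub_ne_zero.2 hab.symm) (sub_ne_zero.2 hbd))
    have z2 := (mul_eq_zero.1 ((smul_eq_zero.1 y2).resolve_right hw0)).resolve_right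
      (mul_ne_zero (sub_ne_zero.2 had.symm) (sub_ne_zero.2 hbd.symm))
    apply hx0
    ext i
    fin_cases i <;> simp [z0, z1, z2]
  · have r0 : Matrix.of ![u, v, w] 0 = u := rfl
    have r1 : Matrix.of ![u, v, w] 1 = v := rfl
    have r2 : Matrix.of ![u, v, w] 2 = w := rfl
    simp only [ac, r0, r1, r2, cyc]
    rw [ez a u hu ha, ez b v hv hb, ez d w hw hd, 
      dz a b u v hu hv (pz a b d hprod had),
      dz a d u w hu hw (pz a d b (by linear_combination hprod) hab),
      dz b a v u hv hu (pz b a d (by linear_combination hprod) hbd),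
      dz b d v w hv hw (pz b d a (by linear_combination hprod) hab.symm),
      dz d a w u hw hu (pz d a b (by linear_combination hprod) hbd.symm),
      dz d b w v hw hv (pz d b a (by linear_combination hprod) had.symm)]

end Cases

section Final
set_option linter.unusedSimpArgs false
open scoped Matrix

theorem tors (A B D X Y : ℚ) (hD : D ≠ 0) (h1 : Y ^ 2 = X ^ 3 + A * D ^ 4 * X + B * D ^ 6)
    (h2 : (3 * X ^ 2 + A * D ^ 4) ^ 2 = 12 * X * Y ^ 2) (hY : Y ≠ 0) :
    ∃ p : (⟨0, 0, 0, A, B⟩ : WeierstrassCurve ℚ).toAffine.Point, 3 • p = 0 ∧ p ≠ 0 := by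
  obtain ⟨x, hx⟩ : ∃ x, x = X / D ^ 2 := ⟨_, rfl⟩
  obtain ⟨y, hy⟩ : ∃ y, y = Y / D ^ 3 := ⟨_, rfl⟩
  have hX : X = x * D ^ 2 := by rw [hx]; field_simp
  have hYY : Y = y * D ^ 3 := by rw [hy]; field_simp
  have hy0 : y ≠ 0 := by rw [hy]; exact div_ne_zero hY (pow_ne_zero _ hD)
  have g1 : y ^ 2 = x ^ 3 + A * x + B := by
    rw [hX, hYY] at h1
    have : D ^ 6 ≠ 0 := pow_ne_zero _ hD
    apply mul_left_cancel₀ this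
    linear_combination h1
  have g2 : (3 * x ^ 2 + A) ^ 2 = 12 * x * y ^ 2 := by
    rw [hX, hYY] at h2
    have : D ^ 8 ≠ 0 := pow_ne_zero _ hD
    apply mul_left_cancel₀ this
    linear_combination h2
  have hyn : y ≠ -y := by
    intro h; apply hy0; linarith
  have ns : (⟨0, 0, 0, A, B⟩ : WeierstrassCurve ℚ).toAffine.Nonsingular x y := by
    rw [WeierstrassCurve.Affine.nonsingular_iff, WeierstrassCurve.Affine.equation_iff]
    refine ⟨by simp; linear_combination g1, Or.inr (by simpa using hyn)⟩
  refine ⟨.some x y ns, ?_, WeierstrassCurve.Affine.Point.some_ne_zero _⟩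
  have hneg : y ≠ (⟨0, 0, 0, A, B⟩ : WeierstrassCurve ℚ).toAffine.negY x y := by
    simpa [WeierstrassCurve.Affine.negY] using hyn
  have hs : (⟨0, 0, 0, A, B⟩ : WeierstrassCurve ℚ).toAffine.slope x x y y
      = (3 * x ^ 2 + A) / (2 * y) := by
    rw [WeierstrassCurve.Affine.slope_of_Y_ne rfl hneg]
    simp [WeierstrassCurve.Affine.negY]
    ring
  have hl : ((3 * x ^ 2 + A) / (2 * y)) ^ 2 = 3 * x := by
    field_simp
    linear_combination g2
  have hdbl : (.some x y ns : (⟨0, 0, 0, A, B⟩ : WeierstrassCurve ℚ).toAffine.Point) + .some x y ns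
      = - .some x y ns := by
    rw [WeierstrassCurve.Affine.Point.add_self_of_Y_ne hneg, WeierstrassCurve.Affine.Point.neg_some]
    have ex : (⟨0, 0, 0, A, B⟩ : WeierstrassCurve ℚ).toAffine.addX x x
        ((⟨0, 0, 0, A, B⟩ : WeierstrassCurve ℚ).toAffine.slope x x y y) = x := by
      rw [hs, WeierstrassCurve.Affine.addX, hl]
      simp
      ring
    have ey : (⟨0, 0, 0, A, B⟩ : WeierstrassCurve ℚ).toAffine.addY x x y
        ((⟨0, 0, 0, A, B⟩ : WeierstrassCurve ℚ).toAffine.slope x x y y)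
        = (⟨0, 0, 0, A, B⟩ : WeierstrassCurve ℚ).toAffine.negY x y := by
      rw [WeierstrassCurve.Affine.addY, WeierstrassCurve.Affine.negAddY, ex]
      simp
    congr 1
  rw [show (3 : ℕ) = 2 + 1 from rfl, add_smul, two_smul, one_smul, hdbl, neg_add_cancel]

theorem roots3 (t s : ℤ) (h : ∀ x : ℚ, x ^ 3 - t * x ^ 2 + s * x - 1 ≠ 0) :
    ∃ a b d : ℂ, a ≠ b ∧ a ≠ d ∧ b ≠ d ∧ (a ^ 3 - t * a ^ 2 + s * a - 1 = 0) ∧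
      (b ^ 3 - t * b ^ 2 + s * b - 1 = 0) ∧ (d ^ 3 - t * d ^ 2 + s * d - 1 = 0) := by
  classical
  set q : Cubic ℚ := ⟨1, -t, s, -1⟩ with hq
  have hdeg : q.toPoly.natDegree = 3 := Cubic.natDegree_of_a_ne_zero (by simp [hq])
  have hirr : Irreducible q.toPoly := by
    rw [Polynomial.irreducible_iff_roots_eq_zero_of_degree_le_three (by omega) (by omega)]
    rw [Multiset.eq_zero_iff_forall_notMem]
    intro x hx
    apply h x
    have := Polynomial.isRoot_of_mem_roots hx
    simp [Cubic.toPoly, hq] at this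
    linear_combination this
  have hcard := Polynomial.card_rootSet_eq_natDegree (K := ℂ) hirr.separable
    (IsAlgClosed.splits _)
  rw [hdeg, ← Set.toFinset_card, Finset.card_eq_three] at hcard
  obtain ⟨a, b, d, hab, had, hbd, hS⟩ := hcard
  have key : ∀ x ∈ ({a, b, d} : Finset ℂ), x ^ 3 - t * x ^ 2 + s * x - 1 = 0 := by
    intro x hx
    rw [← hS, Set.mem_toFinset, Polynomial.mem_rootSet] at hx
    have := hx.2
    simp [Cubic.toPoly, hq] at this
    linear_combination this
  exact ⟨a, b, d, hab, had, hbd, key a (by simp), key b (by simp), key d (by simp)⟩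

end Final

section Main
set_option linter.unusedSimpArgs false
open scoped Matrix

theorem end_three {P Q : MvPolynomial (Fin 10) ℚ} (hPQ : IsInvariantPair ℚ P Q)
    (c : Fin 10 → ℚ) (hΔ : (4 * (aeval c P) ^ 3 - (aeval c Q) ^ 2) / 27 ≠ 0)
    (E : WeierstrassCurve ℚ) (hE : E = ⟨0, 0, 0, -(aeval c P / 3), -(aeval c Q / 27)⟩)
    (htor : ∀ p : E.toAffine.Point, 3 • p = 0 → p = 0)
    (G : Matrix (Fin 3) (Fin 3) ℚ) (a b d e : ℚ) (hG : G.det ≠ 0) (h : ac G c = cyc a b d e) :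
    False := by
  obtain ⟨i1, i2⟩ := inv_gen hPQ c G
  obtain ⟨j1, j2⟩ := cyc_inv hPQ a b d e
  rw [← h, i1] at j1
  rw [← h, i2] at j2
  subst hE
  set I := aeval c P
  set J := aeval c Q
  set D := G.det
  rw [cycI] at j1
  rw [cycJ] at j2
  obtain ⟨Y, hY⟩ : ∃ Y : ℚ, Y = (9*a^3 - 3*a^2*e - 3*a*b*d + a*e^2 + b^3 - b*d*e + d^3) / 2 :=
    ⟨_, rfl⟩
  obtain ⟨X, hX⟩ : ∃ X : ℚ, X = (6*a - e)^2 / 12 := ⟨_, rfl⟩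
  have h1 : Y ^ 2 = X ^ 3 + -(I / 3) * D ^ 4 * X + -(J / 27) * D ^ 6 := by
    rw [hY, hX]
    linear_combination ((6*a - e)^2 / 12 / 48) * j1 + (1 / 864) * j2
  have hA : -(I / 3) * D ^ 4 = -(-(216 * a^3*e - 432*a^2*b*d + 144*a*b^3 - 72*a*b*d*e + 144*a*d^3
      - 24*b^3*e + 24*b*d*e^2 - 24*d^3*e - e^4)) / 48 := by
    linear_combination (-1 / 48) * j1
  have h2 : (3 * X ^ 2 + -(I / 3) * D ^ 4) ^ 2 = 12 * X * Y ^ 2 := by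
    rw [hA, hX, hY]
    ring
  have hY0 : Y ≠ 0 := by
    intro h0
    rw [h0] at h1 h2
    apply hΔ
    have k1 : 3 * X ^ 2 + -(I / 3) * D ^ 4 = 0 := by
      apply pow_eq_zero_iff (two_ne_zero) |>.1
      rw [h2]; ring
    have k2 : I * D ^ 4 = 9 * X ^ 2 := by linear_combination -3 * k1
    have k3 : J * D ^ 6 = -54 * X ^ 3 := by
      linear_combination 27 * h1 - 9 * X * k2
    have k4 : D ^ 12 * (4 * I ^ 3 - J ^ 2) = 0 := by
      have : D ^ 12 * (4 * I ^ 3 - J ^ 2) = 4 * (I * D ^ 4) ^ 3 - (J * D ^ 6) ^ 2 := by ring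
      rw [this, k2, k3]; ring
    rw [(mul_eq_zero.1 k4).resolve_left (pow_ne_zero _ hG), zero_div]
  obtain ⟨p, hp, hp0⟩ := tors _ _ D X Y hG h1 h2 hY0
  exact hp0 (htor p hp)

theorem end_diag {P Q : MvPolynomial (Fin 10) ℚ} (hPQ : IsInvariantPair ℚ P Q)
    (c : Fin 10 → ℚ) (hΔ : (4 * (aeval c P) ^ 3 - (aeval c Q) ^ 2) / 27 ≠ 0)
    (G : Matrix (Fin 3) (Fin 3) ℂ) (e : ℂ) (hG : G.det ≠ 0)
    (h : ac G (fun k => (c k : ℂ)) = cyc 0 0 0 e) : False := by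
  obtain ⟨i1, i2⟩ := inv_gen hPQ (fun k => (c k : ℂ)) G
  obtain ⟨j1, j2⟩ := cyc_inv hPQ (0 : ℂ) 0 0 e
  rw [← h, i1] at j1
  rw [← h, i2] at j2
  have p1 := aeval_push P (Algebra.ofId ℚ ℂ) c
  have p2 := aeval_push Q (Algebra.ofId ℚ ℂ) c
  simp only [Algebra.ofId_apply, eq_ratCast] at p1 p2
  rw [← p1] at j1
  rw [← p2] at j2
  simp only [cycI] at j1
  simp only [cycJ] at j2
  apply hΔ
  set I := aeval c P
  set J := aeval c Q
  set D := G.det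
  have k : D ^ 12 * (4 * (I : ℂ) ^ 3 - (J : ℂ) ^ 2) = 0 := by
    have k1 : D ^ 4 * (I : ℂ) = e ^ 4 / 16 := by linear_combination (1 / 16) * j1
    have k2 : D ^ 6 * (J : ℂ) = -e ^ 6 / 32 := by linear_combination (1 / 32) * j2
    have : D ^ 12 * (4 * (I : ℂ) ^ 3 - (J : ℂ) ^ 2)
      = 4 * (D ^ 4 * (I : ℂ)) ^ 3 - (D ^ 6 * (J : ℂ)) ^ 2 := by ring
    rw [this, k1, k2]; ring
  have k2 := (mul_eq_zero.1 k).resolve_left (pow_ne_zero _ hG)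
  have k3 : 4 * I ^ 3 - J ^ 2 = 0 := by exact_mod_cast k2
  rw [k3, zero_div]

theorem cast_inv {K : Type*} [CommRing K] (c : Fin 10 → ℤ) (g : Matrix (Fin 3) (Fin 3) ℤ)
    (h : ac g c = c) (hdet : g.det = 1) :
    ac (g.map (Int.castRingHom K)) (fun k => (c k : K)) = (fun k => (c k : K)) ∧
    (g.map (Int.castRingHom K)).det = 1 ∧ (g.map (Int.castRingHom K)).trace = ((g.trace : ℤ) : K) ∧
    mns (g.map (Int.castRingHom K)) = ((mns g : ℤ) : K) := by
  refine ⟨?_, ?_, ?_, ?_⟩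
  · ext k
    have := map_ac (Int.castRingHom K) g c k
    rw [h] at this
    simpa using this.symm
  · have := RingHom.map_det (Int.castRingHom K) g
    rw [hdet] at this
    simpa using this.symm
  · simp [Matrix.trace, Fin.sum_univ_three]
  · simp [mns]

theorem case_one {c : Fin 10 → ℚ} (hc0 : NoFlex c) (M : Matrix (Fin 3) (Fin 3) ℚ)
    (hM : ac M c = c) (hdet : M.det = 1) (t : ℤ) (ht : M.trace = t) (hs : mns M = t)
    (hne : M ≠ 1) (hneg : t ≠ -1)
    (h3 : ∀ (G : Matrix (Fin 3) (Fin 3) ℚ) (a b d e : ℚ), G.det ≠ 0 → ac G c = cyc a b d e → False) :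
    False := by
  obtain ⟨w, hw⟩ : ∃ w : Fin 3 → ℚ, w ᵥ* M - w ≠ 0 := by
    by_contra hcon
    push Not at hcon
    apply hne
    ext i j
    have := congrFun (hcon (Pi.single i 1)) j
    rw [Matrix.single_one_vecMul] at this
    simp only [Pi.sub_apply, Pi.zero_apply] at this
    have hij : M i j = (Pi.single i 1 : Fin 3 → ℚ) j := sub_eq_zero.1 this
    rw [hij]
    simp [Matrix.one_apply, Pi.single_apply, eq_comm]
  obtain ⟨p, hp⟩ : ∃ p, p = w ᵥ* M - w := ⟨_, rfl⟩
  rw [← hp] at hw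
  have hch := ch M hdet w
  rw [ht, hs] at hch
  have hpp : (p ᵥ* M) ᵥ* M = ((t : ℚ) - 1) • (p ᵥ* M) - p := by
    rw [hp]
    simp only [Matrix.sub_vecMul] at hch ⊢
    rw [hch]
    ext i
    simp
    ring
  have hwp : w ᵥ* M = w + p := by rw [hp]; simp
  have hroot : ∀ a : ℚ, a ^ 2 - ((t : ℚ) - 1) * a + 1 = 0 → (a = 1 ∧ t = 3) ∨ (a = -1 ∧ t = -1) := by
    intro a ha
    have := rat_root t t a (by linear_combination (a - 1) * ha)
    rcases this with rfl | rfl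
    · left
      refine ⟨rfl, ?_⟩
      have : (t : ℚ) = 3 := by linarith
      exact_mod_cast this
    · right
      refine ⟨rfl, ?_⟩
      have : (t : ℚ) = -1 := by linarith
      exact_mod_cast this
  by_cases t3 : t = 3
  · subst t3
    by_cases hu : p ᵥ* M - p = 0
    · exact flex3 hc0 hM w p hw hwp (sub_eq_zero.1 hu)
    · refine flex3 hc0 hM p (p ᵥ* M - p) hu (by simp) ?_
      rw [Matrix.sub_vecMul, hpp]
      ext i
      simp
      ring
  by_cases t0 : t = 0
  · subst t0
    obtain ⟨u, hu0, hu⟩ := eig M hdet 1 (by rw [ht, hs]; simp)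
    rw [one_smul] at hu
    obtain ⟨G, a, b, d, e, hG, hcy⟩ := case_three hM u p hu0 hu hw (by rw [hpp]; simp)
    exact h3 G a b d e hG hcy
  · refine case_gen hc0 hM ((t : ℚ) - 1) p hw hpp ?_ ?_ ?_
    · intro h; apply t0; have : (t : ℚ) = 0 := by linarith
      exact_mod_cast this
    · intro h; apply t3; have : (t : ℚ) = 3 := by linarith
      exact_mod_cast this
    · intro a ha
      rcases hroot a ha with h | h
      · exact t3 h.2
      · exact hneg h.2

theorem vieta (t s a b d : ℂ) (hab : a ≠ b) (had : a ≠ d) (hbd : b ≠ d)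
    (ha : a ^ 3 - t * a ^ 2 + s * a - 1 = 0) (hb : b ^ 3 - t * b ^ 2 + s * b - 1 = 0)
    (hd : d ^ 3 - t * d ^ 2 + s * d - 1 = 0) : a * b * d = 1 := by
  have h1 : a ^ 2 + a * b + b ^ 2 - t * (a + b) + s = 0 := by
    apply mul_left_cancel₀ (sub_ne_zero.2 hab)
    linear_combination ha - hb
  have h2 : a ^ 2 + a * d + d ^ 2 - t * (a + d) + s = 0 := by
    apply mul_left_cancel₀ (sub_ne_zero.2 had)
    linear_combination ha - hd
  have h3 : a + b + d - t = 0 := by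
    apply mul_left_cancel₀ (sub_ne_zero.2 hbd)
    linear_combination h1 - h2
  linear_combination ha - a * h1 + (a * b) * h3

theorem cube_ne (t s : ℤ) (h : ∀ x : ℚ, x ^ 3 - t * x ^ 2 + s * x - 1 ≠ 0) (a : ℂ)
    (ha : a ^ 3 - t * a ^ 2 + s * a - 1 = 0) : a ^ 3 ≠ 1 := by
  intro h3
  have a0 : a ≠ 0 := by rintro rfl; simp at h3
  have h4 : (t : ℂ) * a = s := by
    apply mul_left_cancel₀ a0
    linear_combination h3 - ha
  by_cases t0 : t = 0
  · subst t0
    have : s = 0 := by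
      have : (s : ℂ) = 0 := by rw [← h4]; simp
      exact_mod_cast this
    subst this
    exact h 1 (by norm_num)
  · have tc : (t : ℂ) ≠ 0 := by exact_mod_cast t0
    have e : a = (((s : ℚ) / (t : ℚ) : ℚ) : ℂ) := by
      push_cast
      rw [eq_div_iff tc, mul_comm]; exact h4
    apply h ((s : ℚ) / (t : ℚ))
    rw [e] at ha
    exact_mod_cast ha

end Main

/-- If `f` is a totally irreducible integral ternary cubic form (strongly irreducible,
`Δ(f) ≠ 0`, and the elliptic curve `y² = x³ − (I(f)/3)x − (J(f)/27)` over `ℚ` has no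
rational point of order 3), then the stabilizer of `f` in `SL₃(ℤ)` is trivial. -/
theorem stmt8 (P Q : MvPolynomial (Fin 10) ℚ) (hPQ : IsInvariantPair ℚ P Q)
    (c : Fin 10 → ℤ)
    (hsi : StronglyIrred c)
    (hΔ : (4 * (aeval (fun k => (c k : ℚ)) P) ^ 3 - (aeval (fun k => (c k : ℚ)) Q) ^ 2) / 27 ≠ 0)
    (E : WeierstrassCurve ℚ)
    (hE : E = ⟨0, 0, 0, -(aeval (fun k => (c k : ℚ)) P / 3),
      -(aeval (fun k => (c k : ℚ)) Q / 27)⟩)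
    (htor : ∀ p : E.toAffine.Point, 3 • p = 0 → p = 0)
    (γ : Matrix.SpecialLinearGroup (Fin 3) ℤ)
    (hγ : actGL (γ : Matrix (Fin 3) (Fin 3) ℤ) (cubic c) = cubic c) :
    γ = 1 := by
  by_contra hne
  have hz : ac (γ : Matrix (Fin 3) (Fin 3) ℤ) c = c := by
    rw [act_cubic] at hγ
    exact cubic_inj hγ
  have hgd : (γ : Matrix (Fin 3) (Fin 3) ℤ).det = 1 := γ.2
  have hne' : (γ : Matrix (Fin 3) (Fin 3) ℤ) ≠ 1 := fun h => hne (Subtype.ext h)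
  generalize (γ : Matrix (Fin 3) (Fin 3) ℤ) = g at hz hgd hne'
  have hc0 := noFlex_of hsi
  obtain ⟨q1, q2, q3, q4⟩ := cast_inv (K := ℚ) c g hz hgd
  obtain ⟨z1, z2, z3, z4⟩ := cast_inv (K := ℂ) c g hz hgd
  by_cases hm : g.trace + mns g = -2
  · have hm' : (g.trace : ℚ) + (mns g : ℤ) = -2 := by exact_mod_cast hm
    obtain ⟨u, hu0, hu⟩ := eig _ q2 (-1) (by rw [q3, q4]; linear_combination -hm')
    exact flex2 hc0 q1 q2 u hu0 (by rw [hu]; simp)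
  by_cases h1 : mns g = g.trace
  · refine case_one hc0 _ q1 q2 g.trace q3 (by rw [q4, h1]) ?_ ?_ ?_
    · intro h
      apply hne'
      ext i j
      have := congrFun (congrFun h i) j
      simp only [Matrix.map_apply, Matrix.one_apply, eq_intCast] at this ⊢
      split_ifs at this ⊢ <;> exact_mod_cast this
    · intro h; omega
    · intro G a b d e hG h
      exact end_three hPQ _ hΔ E hE htor G a b d e hG h
  have hnr : ∀ x : ℚ, x ^ 3 - g.trace * x ^ 2 + (mns g : ℤ) * x - 1 ≠ 0 := by
    intro x hx
    rcases rat_root _ _ x hx with rfl | rfl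
    · apply h1
      have : ((mns g : ℤ) : ℚ) = g.trace := by linarith
      exact_mod_cast this
    · apply hm
      have : (g.trace : ℚ) + (mns g : ℤ) = -2 := by linarith
      exact_mod_cast this
  obtain ⟨a, b, d, hab, had, hbd, ha, hb, hd⟩ := roots3 _ _ hnr
  have hprod := vieta _ _ a b d hab had hbd ha hb hd
  obtain ⟨u, hu0, hu⟩ := eig _ z2 a (by rw [z3, z4]; exact ha)
  obtain ⟨v, hv0, hv⟩ := eig _ z2 b (by rw [z3, z4]; exact hb)
  obtain ⟨w, hw0, hw⟩ := eig _ z2 d (by rw [z3, z4]; exact hd)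
  obtain ⟨G, e, hG, hcy⟩ := case_diag z1 a b d hab had hbd hprod (cube_ne _ _ hnr a ha)
    (cube_ne _ _ hnr b hb) (cube_ne _ _ hnr d hd) u v w hu0 hv0 hw0 hu hv hw
  refine end_diag hPQ _ hΔ G e hG ?_
  rw [← hcy]
  congr 1
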